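/- Let α, β ∈ ℝ with α ≠ 0 and β ≠ 0, and set w(x,y) = y + αx + β. Then for every smooth u : ℝ² → ℝ and every point with w ≠ 0, applying the operator N : u ↦ ∂ₓ∂_y∂_yu − (α/w)·∂_y∂_yu followed by A : v ↦ ∂ₓv + (α/w)·v yields A(N(u)) = ∂ₓ∂ₓ∂_y∂_yu. That is, D_{xxyy} admits the family of factorizations of type (X)(XY²): D_{xxyy} = (Dₓ + α/w)∘(D_{xyy} − (α/w)D_{yy}). -/

import Mathlib

/-- Partial derivative in the first (`x`) variable of a function on the plane. -/
noncomputable def Dx (u : ℝ → ℝ → ℝ) : ℝ → ℝ → ℝ := fun x y => deriv (fun s => u s y) x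

/-- Partial derivative in the second (`y`) variable of a function on the plane. -/
noncomputable def Dy (u : ℝ → ℝ → ℝ) : ℝ → ℝ → ℝ := fun x y => deriv (fun t => u x t) y

/-- A function on the plane is smooth if it is infinitely differentiable as a function
of the pair of variables. -/
def Smooth2 (u : ℝ → ℝ → ℝ) : Prop := ContDiff ℝ (⊤ : ℕ∞) (fun p : ℝ × ℝ => u p.1 p.2)

/-- The first-order operator `Dₓ + p`, sending `u` to `∂ₓu + p·u`. -/
noncomputable def opX (p u : ℝ → ℝ → ℝ) : ℝ → ℝ → ℝ := fun x y => Dx u x y + p x y * u x y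

/-- The first-order operator `D_y + q`, sending `u` to `∂_yu + q·u`. -/
noncomputable def opY (q u : ℝ → ℝ → ℝ) : ℝ → ℝ → ℝ := fun x y => Dy u x y + q x y * u x y

theorem Smooth2.dx {u : ℝ → ℝ → ℝ} (hu : Smooth2 u) : Smooth2 (Dx u) := by
  have h : ∀ p : ℝ × ℝ,
      Dx u p.1 p.2 = fderiv ℝ (fun p : ℝ × ℝ => u p.1 p.2) p (1, 0) := fun p => by
    have hf : HasFDerivAt (fun p : ℝ × ℝ => u p.1 p.2) _ (p.1, p.2) :=
      (ContDiff.differentiable hu (by simp) (p.1, p.2)).hasFDerivAt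
    exact (hf.comp_hasDerivAt p.1 ((hasDerivAt_id p.1).prodMk (hasDerivAt_const p.1 p.2))).deriv
  unfold Smooth2
  simp only [h]
  exact (ContDiff.fderiv_right hu (by simp)).clm_apply contDiff_const

theorem Smooth2.dy {u : ℝ → ℝ → ℝ} (hu : Smooth2 u) : Smooth2 (Dy u) := by
  have h : ∀ p : ℝ × ℝ,
      Dy u p.1 p.2 = fderiv ℝ (fun p : ℝ × ℝ => u p.1 p.2) p (0, 1) := fun p => by
    have hf : HasFDerivAt (fun p : ℝ × ℝ => u p.1 p.2) _ (p.1, p.2) :=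
      (ContDiff.differentiable hu (by simp) (p.1, p.2)).hasFDerivAt
    exact (hf.comp_hasDerivAt p.2 ((hasDerivAt_const p.2 p.1).prodMk (hasDerivAt_id p.2))).deriv
  unfold Smooth2
  simp only [h]
  exact (ContDiff.fderiv_right hu (by simp)).clm_apply contDiff_const

theorem Smooth2.hasDerivAt_dx {u : ℝ → ℝ → ℝ} (hu : Smooth2 u) (x y : ℝ) :
    HasDerivAt (fun s => u s y) (Dx u x y) x := by
  have h : DifferentiableAt ℝ (fun s => u s y) x :=
    (ContDiff.differentiable hu (by simp) (x, y)).comp x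
      (f := fun s : ℝ => (s, y)) (by fun_prop)
  exact h.hasDerivAt

theorem stmt17 (α β : ℝ) (hα : α ≠ 0) (hβ : β ≠ 0) :
    ∀ u : ℝ → ℝ → ℝ, Smooth2 u → ∀ x y : ℝ, y + α * x + β ≠ 0 →
      opX (fun x y => α / (y + α * x + β))
          (fun x y => Dx (Dy (Dy u)) x y
            - (α / (y + α * x + β)) * Dy (Dy u) x y) x y
        = Dx (Dx (Dy (Dy u))) x y := by
  intro u hu x y hw
  have hv : Smooth2 (Dy (Dy u)) := hu.dy.dy
  have hw' : HasDerivAt (fun s => y + α * s + β) α x := by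
    simpa using (((hasDerivAt_id x).const_mul α).const_add y).add_const β
  have hN := (hv.dx.hasDerivAt_dx x y).sub
    (((hasDerivAt_const x α).div hw' hw).mul (hv.hasDerivAt_dx x y))
  have hD : Dx (fun x y => Dx (Dy (Dy u)) x y - (α / (y + α * x + β)) * Dy (Dy u) x y) x y = _ :=
    hN.deriv
  simp only [opX, hD, Pi.div_apply]
  field_simp
  ring
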